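/- arXiv:1807.06577 — 3 statements merged into one kernel-verified Lean document; each statement's English description precedes it below -/
import Mathlib

section
/- Let β > 0 be real with β ≠ 1, and let k ≥ 1 be an integer. Then |log h_β(β^{2k})| = log(β^{2k+1} + 1) − log(β + β^{2k}), and this quantity is strictly smaller than |log β|, where h_β(x) := (β + x)/(βx + 1) and log is the real natural logarithm. -/
/-- For real `β > 0`, `β ≠ 1` and `k ≥ 1`, one has
`|log h_β(β^{2k})| = log(β^{2k+1} + 1) − log(β + β^{2k})`, and this is strictly
smaller than `|log β|`, where `h_β(x) = (β + x)/(βx + 1)`. -/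
theorem abs_log_h_beta (β : ℝ) (hβ : 0 < β) (hβ1 : β ≠ 1) (k : ℕ) (hk : 1 ≤ k) :
    |Real.log ((β + β ^ (2 * k)) / (β * β ^ (2 * k) + 1))|
      = Real.log (β ^ (2 * k + 1) + 1) - Real.log (β + β ^ (2 * k)) ∧
    Real.log (β ^ (2 * k + 1) + 1) - Real.log (β + β ^ (2 * k)) < |Real.log β| := by
  obtain ⟨x, hx⟩ : ∃ x, x = β ^ (2 * k) := ⟨_, rfl⟩
  have hpow : β ^ (2 * k + 1) = β * x := by rw [hx, pow_succ']
  have hx0 : 0 < x := hx ▸ pow_pos hβ _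
  have hle : β + x ≤ β * x + 1 := by
    have key : 0 ≤ (β - 1) * (x - 1) := by
      rcases le_total β 1 with h | h
      · exact mul_nonneg_of_nonpos_of_nonpos (sub_nonpos.2 h)
          (sub_nonpos.2 (hx ▸ pow_le_one₀ hβ.le h))
      · exact mul_nonneg (sub_nonneg.2 h) (sub_nonneg.2 (hx ▸ one_le_pow₀ h))
    linarith
  have hnum : 0 < β + x := by positivity
  have hden : 0 < β * x + 1 := by positivity
  rw [hpow, ← hx]
  constructor
  · rw [Real.log_div hnum.ne' hden.ne',
      abs_of_nonpos (sub_nonpos.2 (Real.log_le_log hnum hle)), neg_sub]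
  · rcases lt_or_gt_of_ne hβ1 with h | h
    · rw [abs_of_neg (Real.log_neg hβ h), lt_neg_iff_add_neg, ← add_sub_right_comm, sub_neg,
        ← Real.log_mul hden.ne' hβ.ne']
      exact Real.log_lt_log (by positivity)
        (by nlinarith [mul_pos hx0 (mul_pos (sub_pos.2 h) (by linarith : 0 < 1 + β))])
    · rw [abs_of_pos (Real.log_pos h), sub_lt_iff_lt_add, ← Real.log_mul hβ.ne' hnum.ne']
      exact Real.log_lt_log hden (by nlinarith)
end

section
/- Let β > 0 be real with β ≠ 1, and let k ≥ 1 be an integer. Set L := |log h_β(β^{2k})| and define p_β : ℝ → ℝ by p_β(a) := log((e^a − β)/(1 − β·e^a)). Then p_β restricted to the closed interval [−L, L] is a bijection from [−L, L] onto the closed interval [−2k|log β|, 2k|log β|]. -/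
open Set in
theorem Function.Odd.bijOn_Icc_abs {g : ℝ → ℝ} (hodd : Function.Odd g) (hc : Continuous g)
    (hi : Function.Injective g) (M : ℝ) :
    BijOn g (Icc (-|M|) |M|) (Icc (-|g M|) |g M|) := by
  have h0 : g 0 = 0 := by
    have := hodd 0
    rw [neg_zero] at this
    linarith
  have habs : ∀ x, |g (|x|)| = |g x| := fun x => by
    rcases abs_choice x with h | h <;> rw [h]
    rw [hodd, abs_neg]
  refine ⟨fun b hb => ?_, hi.injOn, fun y hy => ?_⟩
  · rw [mem_Icc, ← abs_le] at hb ⊢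
    rw [← habs b, ← habs M]
    rcases hc.strictMono_of_inj hi with hm | hm
    · have h1 := hm.monotone (abs_nonneg b)
      rw [h0] at h1
      exact abs_le_abs_of_nonneg h1 (hm.monotone hb)
    · have h1 := hm.antitone (abs_nonneg b)
      rw [h0] at h1
      exact abs_le_abs_of_nonpos h1 (hm.antitone hb)
  · have hsub := intermediate_value_uIcc (a := -|M|) (b := |M|) hc.continuousOn
    rw [uIcc_of_le (neg_le_self (abs_nonneg M)), hodd] at hsub
    refine hsub ?_
    rw [← habs M] at hy
    rcases abs_choice (g |M|) with h | h <;> rw [h] at hy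
    · exact Icc_subset_uIcc hy
    · rw [neg_neg] at hy
      exact Icc_subset_uIcc' hy

section

variable {β : ℝ}

theorem log_div_comp_exp_leftInverse (hβ : 0 < β) (hβ1 : β ≠ 1) :
    Function.LeftInverse (fun a : ℝ => Real.log ((Real.exp a - β) / (1 - β * Real.exp a)))
      (fun b : ℝ => Real.log ((β + Real.exp b) / (β * Real.exp b + 1))) := by
  intro b
  have hx := Real.exp_pos b
  have hd : 0 < β * Real.exp b + 1 := by positivity
  have hβ2 : 1 - β ^ 2 ≠ 0 := by
    intro h
    have : (1 - β) * (1 + β) = 0 := by linarith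
    rcases mul_eq_zero.mp this with h | h
    · exact hβ1 (by linarith)
    · linarith
  have hnum : (β + Real.exp b) / (β * Real.exp b + 1) - β
      = Real.exp b * ((1 - β ^ 2) / (β * Real.exp b + 1)) := by
    field_simp
    ring
  have hden : 1 - β * ((β + Real.exp b) / (β * Real.exp b + 1))
      = (1 - β ^ 2) / (β * Real.exp b + 1) := by
    field_simp
    ring
  dsimp only
  rw [Real.exp_log (by positivity), hnum, hden,
    mul_div_cancel_right₀ _ (div_ne_zero hβ2 hd.ne'), Real.log_exp]

theorem continuous_log_div_comp_exp (hβ : 0 < β) :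
    Continuous (fun b : ℝ => Real.log ((β + Real.exp b) / (β * Real.exp b + 1))) := by
  have h1 : ∀ b, β * Real.exp b + 1 ≠ 0 := fun b => by positivity
  have h2 : ∀ b, (β + Real.exp b) / (β * Real.exp b + 1) ≠ 0 := fun b => by positivity
  exact Continuous.log (Continuous.div (by fun_prop) (by fun_prop) h1) h2

theorem odd_log_div_comp_exp (β : ℝ) :
    Function.Odd (fun b : ℝ => Real.log ((β + Real.exp b) / (β * Real.exp b + 1))) := by
  intro b
  have hx := Real.exp_pos b
  dsimp only
  rw [← Real.log_inv, Real.exp_neg, inv_div,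
    ← mul_div_mul_right (β + (Real.exp b)⁻¹) _ hx.ne']
  congr 2 <;> field_simp

end

/-- With `L = |log h_β(β^{2k})|` and `p_β(a) = log((e^a − β)/(1 − β e^a))`,
`p_β` maps `[−L, L]` bijectively onto `[−2k|log β|, 2k|log β|]`. -/
theorem p_beta_bijOn (β : ℝ) (hβ : 0 < β) (hβ1 : β ≠ 1) (k : ℕ) (hk : 1 ≤ k) :
    Set.BijOn (fun a : ℝ => Real.log ((Real.exp a - β) / (1 - β * Real.exp a)))
      (Set.Icc (-|Real.log ((β + β ^ (2 * k)) / (β * β ^ (2 * k) + 1))|)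
        |Real.log ((β + β ^ (2 * k)) / (β * β ^ (2 * k) + 1))|)
      (Set.Icc (-(2 * (k : ℝ) * |Real.log β|)) (2 * (k : ℝ) * |Real.log β|)) := by
  have hinv := log_div_comp_exp_leftInverse hβ hβ1
  have hexp : Real.exp (2 * (k : ℝ) * Real.log β) = β ^ (2 * k) := by
    rw [← Real.exp_log (pow_pos hβ (2 * k)), Real.log_pow]
    push_cast
    rfl
  have habs : |2 * (k : ℝ) * Real.log β| = 2 * (k : ℝ) * |Real.log β| := by
    rw [abs_mul, abs_of_nonneg (by positivity)]
  have hbij := (odd_log_div_comp_exp β).bijOn_Icc_abs (continuous_log_div_comp_exp hβ)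
    hinv.injective (2 * (k : ℝ) * Real.log β)
  rw [habs] at hbij
  simp only [hexp] at hbij
  exact hbij.symm ⟨fun y hy => by
    obtain ⟨b, -, rfl⟩ := hbij.surjOn hy
    exact congrArg (fun b : ℝ => Real.log ((β + Real.exp b) / (β * Real.exp b + 1))) (hinv b),
    fun b _ => hinv b⟩
end

section
/- Let k ≥ 0 be an integer and let δ > 0 and β > 0 be reals with β ≠ 1. Then q_β(C_2(β, δ, k)) = {z ∈ ℂ : |Re(z)| ≤ 2k|log β| and |Im(z)| ≤ k·δ}, i.e. the image of C_2(β, δ, k) under q_β is exactly the rectangle k·R(2|log β|, δ). -/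
/-- `p_β(a) = log((e^a − β)/(1 − β e^a))` on the reals. -/
noncomputable def pReal (β a : ℝ) : ℝ := Real.log ((Real.exp a - β) / (1 - β * Real.exp a))

/-- The derivative `p_β'(a) = (1 − β²)/(2β(cosh(log β) − cosh a))`. -/
noncomputable def pReal' (β a : ℝ) : ℝ :=
  (1 - β ^ 2) / (2 * β * (Real.cosh (Real.log β) - Real.cosh a))

/-- The (non-analytic) approximation `q_β(a + bi) = p_β(a) + p_β'(a)·b·i`. -/
noncomputable def qMap (β : ℝ) (z : ℂ) : ℂ :=
  (pReal β z.re : ℂ) + (pReal' β z.re : ℂ) * (z.im : ℂ) * Complex.I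

/-- `i_{k,δ}(x) = k·δ·(cosh(log β) − cosh x)·2β/|1−β²|`. -/
noncomputable def iBound (β δ : ℝ) (k : ℕ) (x : ℝ) : ℝ :=
  (k : ℝ) * δ * (Real.cosh (Real.log β) - Real.cosh x) * (2 * β / |1 - β ^ 2|)

/-- The convex region `C₂(β, δ, k)`, with `h_β(x) = (β + x)/(βx + 1)`. -/
noncomputable def C2 (β δ : ℝ) (k : ℕ) : Set ℂ :=
  {z : ℂ | |z.re| ≤ |Real.log ((β + β ^ (2 * k)) / (β * β ^ (2 * k) + 1))| ∧
    |z.im| ≤ iBound β δ k z.re}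

/-- The inverse of `pReal β`, namely `t ↦ log (h_β (e^t))` with `h_β(x) = (β + x)/(βx + 1)`. -/
noncomputable def pRealInv (β t : ℝ) : ℝ :=
  Real.log ((β + Real.exp t) / (β * Real.exp t + 1))

theorem one_sub_sq_ne_zero {β : ℝ} (hβ : 0 < β) (hβ1 : β ≠ 1) : 1 - β ^ 2 ≠ 0 :=
  fun h => hβ1 ((pow_eq_one_iff_of_nonneg hβ.le two_ne_zero).1 (sub_eq_zero.1 h).symm)

theorem pReal_pRealInv {β : ℝ} (hβ : 0 < β) (hβ1 : β ≠ 1) (t : ℝ) :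
    pReal β (pRealInv β t) = t := by
  have hx := Real.exp_pos t
  have hd : 0 < β * Real.exp t + 1 := by positivity
  have hne := one_sub_sq_ne_zero hβ hβ1
  have hn : (β + Real.exp t) / (β * Real.exp t + 1) - β
      = Real.exp t * ((1 - β ^ 2) / (β * Real.exp t + 1)) := by
    field_simp
    ring
  have hm : 1 - β * ((β + Real.exp t) / (β * Real.exp t + 1))
      = (1 - β ^ 2) / (β * Real.exp t + 1) := by
    field_simp
    ring
  rw [pReal, pRealInv, Real.exp_log (by positivity), hn, hm,
    mul_div_cancel_right₀ _ (div_ne_zero hne hd.ne'), Real.log_exp]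

theorem pRealInv_pReal {β a : ℝ} (hβ : 0 < β) (hβ1 : β ≠ 1)
    (ha : Real.cosh a < Real.cosh (Real.log β)) : pRealInv β (pReal β a) = a := by
  have hy := Real.exp_pos a
  have hprod : 0 < (Real.exp a - β) * (1 - β * Real.exp a) := by
    have h : (Real.exp a - β) * (1 - β * Real.exp a)
        = 2 * β * Real.exp a * (Real.cosh (Real.log β) - Real.cosh a) := by
      rw [Real.cosh_log hβ, Real.cosh_eq, Real.exp_neg]
      field_simp
      ring
    rw [h]
    have := sub_pos.2 ha
    positivity
  have hne := one_sub_sq_ne_zero hβ hβ1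
  have hm : 1 - β * Real.exp a ≠ 0 := right_ne_zero_of_mul hprod.ne'
  have hr : 0 < (Real.exp a - β) / (1 - β * Real.exp a) := by
    rw [← mul_div_mul_right _ _ hm]
    exact div_pos hprod (mul_self_pos.2 hm)
  have hn : β + (Real.exp a - β) / (1 - β * Real.exp a)
      = Real.exp a * ((1 - β ^ 2) / (1 - β * Real.exp a)) := by
    field_simp
    ring
  have hd : β * ((Real.exp a - β) / (1 - β * Real.exp a)) + 1
      = (1 - β ^ 2) / (1 - β * Real.exp a) := by
    field_simp
    ring
  rw [pRealInv, pReal, Real.exp_log hr, hn, hd,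
    mul_div_cancel_right₀ _ (div_ne_zero hne hm), Real.log_exp]

theorem cosh_pRealInv {β : ℝ} (hβ : 0 < β) (t : ℝ) :
    Real.cosh (pRealInv β t) = (Real.cosh (Real.log β) * Real.cosh t + 1) /
      (Real.cosh (Real.log β) + Real.cosh t) := by
  have hx := Real.exp_pos t
  rw [pRealInv, Real.cosh_log (by positivity), Real.cosh_log hβ, Real.cosh_eq, Real.exp_neg]
  generalize Real.exp t = x at hx
  have h : 0 < (β + β⁻¹) / 2 + (x + x⁻¹) / 2 := by positivity
  rw [eq_div_iff h.ne']
  field_simp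
  ring

theorem one_lt_cosh_log {β : ℝ} (hβ : 0 < β) (hβ1 : β ≠ 1) : 1 < Real.cosh (Real.log β) :=
  Real.one_lt_cosh.2 (Real.log_ne_zero_of_pos_of_ne_one hβ hβ1)

theorem cosh_pRealInv_lt {β : ℝ} (hβ : 0 < β) (hβ1 : β ≠ 1) (t : ℝ) :
    Real.cosh (pRealInv β t) < Real.cosh (Real.log β) := by
  have hb := one_lt_cosh_log hβ hβ1
  have hc := Real.cosh_pos t
  rw [cosh_pRealInv hβ, div_lt_iff₀ (by linarith)]
  nlinarith

theorem abs_pRealInv_le_abs_pRealInv_iff {β : ℝ} (hβ : 0 < β) (hβ1 : β ≠ 1) (t s : ℝ) :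
    |pRealInv β t| ≤ |pRealInv β s| ↔ |t| ≤ |s| := by
  have hb := one_lt_cosh_log hβ hβ1
  have ht := Real.cosh_pos t
  have hs := Real.cosh_pos s
  rw [← Real.cosh_le_cosh, ← Real.cosh_le_cosh, cosh_pRealInv hβ, cosh_pRealInv hβ,
    div_le_div_iff₀ (by linarith) (by linarith)]
  have hb2 : 0 < Real.cosh (Real.log β) ^ 2 - 1 := by nlinarith
  rw [← mul_le_mul_iff_right₀ hb2 (b := Real.cosh t)]
  constructor <;> intro h <;> linarith

theorem abs_pReal'_mul_iBound {β δ a : ℝ} (hβ : 0 < β) (hβ1 : β ≠ 1) (k : ℕ)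
    (ha : Real.cosh a < Real.cosh (Real.log β)) : |pReal' β a| * iBound β δ k a = k * δ := by
  have hne := one_sub_sq_ne_zero hβ hβ1
  have hD := sub_pos.2 ha
  have hpos : 0 < 2 * β * (Real.cosh (Real.log β) - Real.cosh a) := by positivity
  have habs : |1 - β ^ 2| ≠ 0 := abs_ne_zero.2 hne
  rw [pReal', iBound, abs_div, abs_of_pos hpos]
  field_simp

theorem pReal'_ne_zero {β a : ℝ} (hβ : 0 < β) (hβ1 : β ≠ 1)
    (ha : Real.cosh a < Real.cosh (Real.log β)) : pReal' β a ≠ 0 := by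
  intro h
  simpa [h] using abs_pReal'_mul_iBound (δ := 1) hβ hβ1 1 ha

theorem qMap_re (β : ℝ) (z : ℂ) : (qMap β z).re = pReal β z.re := by
  simp [qMap]

theorem qMap_im (β : ℝ) (z : ℂ) : (qMap β z).im = pReal' β z.re * z.im := by
  simp [qMap]

theorem mem_C2_iff {β δ : ℝ} (hβ : 0 < β) (k : ℕ) (z : ℂ) :
    z ∈ C2 β δ k ↔ |z.re| ≤ |pRealInv β (2 * k * Real.log β)| ∧ |z.im| ≤ iBound β δ k z.re := by
  have h : Real.exp (2 * k * Real.log β) = β ^ (2 * k) := by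
    rw [← Real.exp_log (pow_pos hβ (2 * k)), Real.log_pow]
    push_cast
    rfl
  rw [pRealInv, h, C2, Set.mem_ofPred_eq]

theorem abs_pReal'_mul_le_iff {β δ a : ℝ} (hβ : 0 < β) (hβ1 : β ≠ 1) (k : ℕ)
    (ha : Real.cosh a < Real.cosh (Real.log β)) (y : ℝ) :
    |pReal' β a * y| ≤ k * δ ↔ |y| ≤ iBound β δ k a := by
  rw [abs_mul, ← abs_pReal'_mul_iBound hβ hβ1 k ha,
    mul_le_mul_iff_right₀ (abs_pos.2 (pReal'_ne_zero hβ hβ1 ha))]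

/-- The image of `C₂(β, δ, k)` under `q_β` is exactly the rectangle
`k·R(2|log β|, δ) = {z : |Re z| ≤ 2k|log β|, |Im z| ≤ kδ}`. -/
theorem qMap_image_C2 (k : ℕ) (δ β : ℝ) (hδ : 0 < δ) (hβ : 0 < β) (hβ1 : β ≠ 1) :
    qMap β '' C2 β δ k
      = {z : ℂ | |z.re| ≤ 2 * (k : ℝ) * |Real.log β| ∧ |z.im| ≤ (k : ℝ) * δ} := by
  have hs : |2 * (k : ℝ) * Real.log β| = 2 * (k : ℝ) * |Real.log β| := by
    rw [abs_mul, abs_of_nonneg (by positivity)]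
  ext w
  rw [Set.mem_image, Set.mem_ofPred_eq, ← hs]
  constructor
  · rintro ⟨z, hz, rfl⟩
    rw [mem_C2_iff hβ] at hz
    have ha : Real.cosh z.re < Real.cosh (Real.log β) :=
      (Real.cosh_le_cosh.2 hz.1).trans_lt (cosh_pRealInv_lt hβ hβ1 _)
    rw [qMap_re, qMap_im, abs_pReal'_mul_le_iff hβ hβ1 k ha,
      ← abs_pRealInv_le_abs_pRealInv_iff hβ hβ1, pRealInv_pReal hβ hβ1 ha]
    exact hz
  · rintro ⟨hre, him⟩
    have ha := cosh_pRealInv_lt hβ hβ1 w.re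
    have hcancel : pReal' β (pRealInv β w.re) * (w.im / pReal' β (pRealInv β w.re)) = w.im :=
      mul_div_cancel₀ _ (pReal'_ne_zero hβ hβ1 ha)
    refine ⟨⟨pRealInv β w.re, w.im / pReal' β (pRealInv β w.re)⟩, ?_, ?_⟩
    · rw [mem_C2_iff hβ]
      refine ⟨(abs_pRealInv_le_abs_pRealInv_iff hβ hβ1 _ _).2 hre, ?_⟩
      rwa [← abs_pReal'_mul_le_iff hβ hβ1 k ha, hcancel]
    · apply Complex.ext
      · rw [qMap_re, pReal_pRealInv hβ hβ1]
      · rw [qMap_im, hcancel]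
end
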